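/- (Localization, compact-set form.) In the standing setting, the polynomial entropy of f satisfies h_pol(f) = sup { h_pol(f; Y) : Y a nonempty compact subset of X∖{∞} }. -/

import Mathlib

open Filter Topology Set
open scoped ENNReal

/-- `E` is `(n, ε)`-separated for `f`: any two distinct points of `E` are `ε`-apart at some
time `k ∈ {0, …, n-1}`. -/
def IsDynSeparated {X : Type*} [MetricSpace X] (f : X → X) (n : ℕ) (ε : ℝ) (E : Set X) : Prop :=
  ∀ x ∈ E, ∀ y ∈ E, x ≠ y → ∃ k < n, ε < dist (f^[k] x) (f^[k] y)

/-- `S(n, ε)`: the maximal cardinality of an `(n, ε)`-separated set. -/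
noncomputable def maxSep {X : Type*} [MetricSpace X] (f : X → X) (n : ℕ) (ε : ℝ) : ℕ :=
  sSup {m | ∃ E : Finset X, IsDynSeparated f n ε ↑E ∧ E.card = m}

/-- Polynomial entropy `h_pol(f) = lim_{ε → 0} limsup_n (log S(n,ε) / log n)`, a value in
`[0, ∞]`.  Since `ε ↦ limsup_n (log S(n,ε) / log n)` is nonincreasing in `ε`, the limit as
`ε → 0⁺` is the supremum over `ε > 0`. -/
noncomputable def polEntropy {X : Type*} [MetricSpace X] (f : X → X) : ℝ≥0∞ :=
  ⨆ (ε : ℝ) (_ : 0 < ε),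
    Filter.atTop.limsup fun n : ℕ =>
      ENNReal.ofReal (Real.log (maxSep f n ε) / Real.log n)

/-- Topological entropy `h_top(f) = lim_{ε → 0} limsup_n (1/n) log S(n,ε)`. -/
noncomputable def topEntropy {X : Type*} [MetricSpace X] (f : X → X) : ℝ≥0∞ :=
  ⨆ (ε : ℝ) (_ : 0 < ε),
    Filter.atTop.limsup fun n : ℕ =>
      ENNReal.ofReal (Real.log (maxSep f n ε) / n)

/-- The set `A_n(ℱ)` of codings of orbit segments of length `n` relative to the finite
family `ℱ`: words `w` with letters in `ℱ ∪ {∞_ℱ}` (where `∞_ℱ` is the complement of `∪ℱ`)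
for which some orbit segment `(x, f x, …, f^{n-1} x)` satisfies `f^k x ∈ w k` for all `k`. -/
def codings {X : Type*} (f : X → X) (F : Finset (Set X)) (n : ℕ) : Set (Fin n → Set X) :=
  {w | (∀ k, w k ∈ F ∨ w k = (⋃₀ (F : Set (Set X)))ᶜ) ∧
      ∃ x : X, ∀ k : Fin n, f^[(k : ℕ)] x ∈ w k}

/-- Coding polynomial entropy of a finite family: `h_pol(f; ℱ) = limsup_n log #A_n(ℱ) / log n`.
For a single set `Y`, `h_pol(f; Y)` is `codingEntropy f {Y}`. -/
noncomputable def codingEntropy {X : Type*} (f : X → X) (F : Finset (Set X)) : ℝ≥0∞ :=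
  Filter.atTop.limsup fun n : ℕ =>
    ENNReal.ofReal (Real.log ((codings f F n).ncard) / Real.log n)

/-- The `n`-th iterate of a homeomorphism, for `n : ℤ`. -/
def zIter {X : Type*} [TopologicalSpace X] (f : X ≃ₜ X) (n : ℤ) (x : X) : X :=
  (f.toEquiv ^ n) x

/-- A set `Z` is wandering if `f^n(Z) ∩ Z = ∅` for every integer `n ≠ 0`. -/
def IsWanderingSet {X : Type*} [TopologicalSpace X] (f : X ≃ₜ X) (Z : Set X) : Prop :=
  ∀ n : ℤ, n ≠ 0 → zIter f n '' Z ∩ Z = ∅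

/-- Standing setting: `p` (the point written `∞` in the paper) is a fixed point of `f`, and
every other point is wandering, i.e. has a wandering neighborhood. -/
def StandingSetting {X : Type*} [TopologicalSpace X] (f : X ≃ₜ X) (p : X) : Prop :=
  f p = p ∧ ∀ x : X, x ≠ p → ∃ U ∈ 𝓝 x, IsWanderingSet f U

/-- `M(Y) = sup_{x ∈ X} #{n ∈ ℤ : f^n(x) ∈ Y}`. -/
noncomputable def orbitCount {X : Type*} [TopologicalSpace X] (f : X ≃ₜ X) (Y : Set X) : ℕ∞ :=
  ⨆ x : X, {n : ℤ | zIter f n x ∈ Y}.encard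

/-- Local polynomial entropy `h^loc_pol(f; S)` of a finite set `S`: the limit, along
decreasing neighborhood bases of the points of `S`, of the coding entropies of the
corresponding families of neighborhoods.  By monotonicity of the coding entropy this limit
equals the infimum of `h_pol(f; {U x : x ∈ S})` over all families `U` of respective
neighborhoods of the points of `S` such that `M(⋃_{x ∈ S} U x) < ∞` (such families exist,
and any decreasing neighborhood basis eventually consists of such sets). -/
noncomputable def localEntropy {X : Type*} [TopologicalSpace X] (f : X ≃ₜ X)
    (S : Finset X) : ℝ≥0∞ :=
  letI := Classical.decEq (Set X)
  ⨅ (U : X → Set X) (_ : ∀ x ∈ S, U x ∈ 𝓝 x)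
    (_ : orbitCount f (⋃ x ∈ S, U x) < ⊤),
    codingEntropy ⇑f (S.image U)

/-- The family `U` of sets (indexed by the points of `S`) is mutually singular: for every
`M` there are a point `x` and times `(N a)_{a ∈ S}` with `f^{N a}(x) ∈ U a` for all `a ∈ S`
and `|N a - N b| > M` for all `a ≠ b` in `S`. -/
def MutuallySingularFam {X : Type*} [TopologicalSpace X] (f : X ≃ₜ X) (S : Finset X)
    (U : X → Set X) : Prop :=
  ∀ M : ℕ, ∃ (x : X) (N : X → ℤ),
    (∀ a ∈ S, zIter f (N a) x ∈ U a) ∧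
    ∀ a ∈ S, ∀ b ∈ S, a ≠ b → (M : ℤ) < |N a - N b|

/-- A finite set `S` is singular if every family of respective neighborhoods of its points
is mutually singular. -/
def IsSingularSet {X : Type*} [TopologicalSpace X] (f : X ≃ₜ X) (S : Finset X) : Prop :=
  ∀ U : X → Set X, (∀ a ∈ S, U a ∈ 𝓝 a) → MutuallySingularFam f S U

/-- Growth rates on the `log n` scale are insensitive to constant factors. -/
theorem limsup_log_div_log_le_of_le_mul {a b : ℕ → ℕ} {C : ℕ} (h : ∀ n, a n ≤ C * b n) :
    Filter.atTop.limsup (fun n : ℕ => ENNReal.ofReal (Real.log (a n) / Real.log n)) ≤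
      Filter.atTop.limsup (fun n : ℕ => ENNReal.ofReal (Real.log (b n) / Real.log n)) := by
  have hlog : ∀ n, Real.log (a n) ≤ Real.log C + Real.log (b n) := by
    intro n
    rcases Nat.eq_zero_or_pos (a n) with h0 | h0
    · simpa [h0] using add_nonneg (Real.log_natCast_nonneg C) (Real.log_natCast_nonneg (b n))
    · have hC : 0 < C * b n := h0.trans_le (h n)
      have hC0 : C ≠ 0 := by rintro rfl; simp at hC
      have hb0 : b n ≠ 0 := by intro hb; simp [hb] at hC
      rw [← Real.log_mul (by exact_mod_cast hC0) (by exact_mod_cast hb0)]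
      exact Real.log_le_log (by exact_mod_cast h0) (by exact_mod_cast h n)
  have hconst : Tendsto (fun n : ℕ => ENNReal.ofReal (Real.log C / Real.log n)) atTop (𝓝 0) := by
    rw [← ENNReal.ofReal_zero]
    exact ENNReal.tendsto_ofReal
      ((Real.tendsto_log_atTop.comp tendsto_natCast_atTop_atTop).const_div_atTop _)
  calc Filter.atTop.limsup (fun n : ℕ => ENNReal.ofReal (Real.log (a n) / Real.log n))
      ≤ Filter.atTop.limsup (fun n : ℕ => ENNReal.ofReal (Real.log C / Real.log n) +
          ENNReal.ofReal (Real.log (b n) / Real.log n)) := by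
        refine Filter.limsup_le_limsup (Eventually.of_forall fun n => ?_)
        refine le_trans (ENNReal.ofReal_le_ofReal ?_) ENNReal.ofReal_add_le
        rw [← add_div]
        exact div_le_div_of_nonneg_right (hlog n) (Real.log_natCast_nonneg n)
    _ = _ := ENNReal.limsup_add_of_left_tendsto_zero hconst _

open scoped Classical in
/-- The times `k < n` at which the orbit of `x` visits `Y`. -/
noncomputable def visits {X : Type*} (f : X → X) (n : ℕ) (Y : Set X) (x : X) : Finset ℕ :=
  (Finset.range n).filter fun k => f^[k] x ∈ Y

theorem mem_visits {X : Type*} {f : X → X} {n : ℕ} {Y : Set X} {x : X} {k : ℕ} :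
    k ∈ visits f n Y x ↔ k < n ∧ f^[k] x ∈ Y := by
  simp [visits]

theorem finite_range_visits {X : Type*} (f : X → X) (n : ℕ) (Y : Set X) :
    (range (visits f n Y)).Finite := by
  refine (Finset.range n).powerset.finite_toSet.subset ?_
  rintro _ ⟨x, rfl⟩
  exact Finset.mem_coe.2 (Finset.mem_powerset.2 fun k hk =>
    Finset.mem_range.2 (mem_visits.1 hk).1)

/-- A coding relative to the single set `Y` amounts to a set of visiting times. -/
theorem ncard_codings_singleton {X : Type*} [Nonempty X] (f : X → X) (n : ℕ) (Y : Set X) :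
    (codings f {Y} n).ncard = (range (visits f n Y)).ncard := by
  classical
  let g : Finset ℕ → Fin n → Set X := fun A k => if (k : ℕ) ∈ A then Y else Yᶜ
  have hne : Y ≠ Yᶜ := fun h => by
    obtain ⟨x⟩ := ‹Nonempty X›
    have hx : x ∈ Y ↔ x ∈ Yᶜ := by rw [← h]
    simp at hx
  have himage : codings f {Y} n = g '' range (visits f n Y) := by
    ext w
    simp only [codings, Finset.mem_singleton, Finset.coe_singleton, sUnion_singleton,
      mem_ofPred_eq, mem_image, mem_range, exists_exists_eq_and]
    constructor
    · rintro ⟨hw, x, hx⟩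
      refine ⟨x, funext fun k => ?_⟩
      simp only [g, mem_visits, k.isLt, true_and]
      have hxk := hx k
      rcases hw k with h | h <;> rw [h] at hxk ⊢
      · exact if_pos hxk
      · exact if_neg hxk
    · rintro ⟨x, rfl⟩
      refine ⟨fun k => ?_, x, fun k => ?_⟩
      · by_cases h : (k : ℕ) ∈ visits f n Y x <;> simp [g, h]
      · by_cases h : f^[(k : ℕ)] x ∈ Y <;> simp [g, mem_visits, h]
  rw [himage]
  refine InjOn.ncard_image ?_
  rintro _ ⟨x, rfl⟩ _ ⟨y, rfl⟩ hxy
  ext k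
  rw [mem_visits, mem_visits]
  refine and_congr_right fun hk => ?_
  have hxy' := congrFun hxy ⟨k, hk⟩
  by_cases h₁ : f^[k] x ∈ Y <;> by_cases h₂ : f^[k] y ∈ Y <;>
    simp_all [g, mem_visits, hne.symm]

theorem zIter_natCast {X : Type*} [TopologicalSpace X] (f : X ≃ₜ X) (k : ℕ) (x : X) :
    zIter f k x = f^[k] x := by
  simp only [zIter, zpow_natCast]
  rw [← Equiv.Perm.iterate_eq_pow]
  rfl

theorem zIter_sub_iterate {X : Type*} [TopologicalSpace X] (f : X ≃ₜ X) (j k : ℕ) (x : X) :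
    zIter f ((k : ℤ) - j) (f^[j] x) = f^[k] x := by
  rw [← zIter_natCast f j, ← zIter_natCast f k]
  simp only [zIter]
  rw [← Equiv.Perm.mul_apply, ← zpow_add, sub_add_cancel]

theorem IsWanderingSet.mono {X : Type*} [TopologicalSpace X] {f : X ≃ₜ X} {Z W : Set X}
    (hW : IsWanderingSet f W) (h : Z ⊆ W) : IsWanderingSet f Z := fun n hn =>
  subset_empty_iff.1 ((hW n hn) ▸ inter_subset_inter (image_mono h) h)

/-- An orbit visits a wandering set at most once. -/
theorem IsWanderingSet.eq_of_iterate_mem {X : Type*} [TopologicalSpace X] {f : X ≃ₜ X}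
    {Z : Set X} (hZ : IsWanderingSet f Z) {x : X} {j k : ℕ} (hj : f^[j] x ∈ Z)
    (hk : f^[k] x ∈ Z) : j = k := by
  by_contra hjk
  have h := hZ ((k : ℤ) - j) (by omega)
  exact (h ▸ (⟨⟨_, hj, zIter_sub_iterate f j k x⟩, hk⟩ :
    f^[k] x ∈ zIter f ((k : ℤ) - j) '' Z ∩ Z) : f^[k] x ∈ (∅ : Set X))

/-- A compact set avoiding the fixed point is covered by finitely many wandering sets of small
diameter; `c` chooses, for each point, the label of a covering set containing it. -/
theorem StandingSetting.exists_finite_wandering_cover {X : Type*} [MetricSpace X] {f : X ≃ₜ X}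
    {p : X} (hst : StandingSetting f p) {K : Set X} (hK : IsCompact K) (hp : p ∉ K) {ε : ℝ}
    (hε : 0 < ε) :
    ∃ (t : Finset X) (U : X → Set X) (c : X → X),
      (∀ i ∈ t, IsWanderingSet f (U i) ∧ ∀ x ∈ U i, ∀ y ∈ U i, dist x y ≤ ε) ∧
      ∀ x ∈ K, c x ∈ t ∧ x ∈ U (c x) := by
  have hU : ∀ x : X, ∃ U : Set X, x ∈ K → U ∈ 𝓝 x ∧ IsWanderingSet f U := by
    intro x
    by_cases hx : x ∈ K
    · obtain ⟨U, hU⟩ := hst.2 x (fun h => hp (h ▸ hx))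
      exact ⟨U, fun _ => hU⟩
    · exact ⟨∅, fun h => absurd h hx⟩
  choose U hU using hU
  obtain ⟨t, htK, ht⟩ := hK.elim_nhds_subcover (fun x => U x ∩ Metric.ball x (ε / 2))
    fun x hx => inter_mem (hU x hx).1 (Metric.ball_mem_nhds x (half_pos hε))
  have hc : ∀ x : X, ∃ i, x ∈ K → i ∈ t ∧ x ∈ U i ∩ Metric.ball i (ε / 2) := by
    intro x
    by_cases hx : x ∈ K
    · obtain ⟨i, hi, hxi⟩ := mem_iUnion₂.1 (ht hx)
      exact ⟨i, fun _ => ⟨hi, hxi⟩⟩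
    · exact ⟨x, fun h => absurd h hx⟩
  choose c hc using hc
  refine ⟨t, fun x => U x ∩ Metric.ball x (ε / 2), c, fun i hi => ⟨?_, ?_⟩, hc⟩
  · exact (hU i (htK i hi)).2.mono inter_subset_left
  · rintro x ⟨-, hx⟩ y ⟨-, hy⟩
    rw [Metric.mem_ball] at hx hy
    linarith [dist_triangle_right x y i]

theorem card_visits_le {X : Type*} [TopologicalSpace X] {f : X ≃ₜ X} {K : Set X}
    {t : Finset X} {U : X → Set X} {c : X → X} (hU : ∀ i ∈ t, IsWanderingSet f (U i))
    (hc : ∀ x ∈ K, c x ∈ t ∧ x ∈ U (c x)) (n : ℕ) (x : X) :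
    (visits f n K x).card ≤ t.card := by
  refine Finset.card_le_card_of_injOn (fun k => c (f^[k] x))
    (fun k hk => (hc _ (mem_visits.1 hk).2).1) ?_
  intro j hj k hk hjk
  have hj' := hc _ (mem_visits.1 hj).2
  have hk' := hc _ (mem_visits.1 hk).2
  have hjk' : c (f^[j] x) = c (f^[k] x) := hjk
  rw [← hjk'] at hk'
  exact (hU _ hj'.1).eq_of_iterate_mem hj'.2 hk'.2

/-- Separated sets are controlled by the visits to the complement of a small ball around the
fixed point. -/
theorem StandingSetting.exists_card_le_mul_ncard_visits {X : Type*} [MetricSpace X]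
    [CompactSpace X] {f : X ≃ₜ X} {p : X} (hst : StandingSetting f p) {ε : ℝ} (hε : 0 < ε) :
    ∃ K : Set X, IsCompact K ∧ p ∉ K ∧ ∃ C : ℕ, ∀ (n : ℕ) (E : Finset X),
      IsDynSeparated f n ε E → E.card ≤ C * (range (visits f n K)).ncard := by
  classical
  have hK : IsCompact (Metric.ball p (ε / 2))ᶜ := Metric.isOpen_ball.isClosed_compl.isCompact
  have hp : p ∉ (Metric.ball p (ε / 2))ᶜ := by simpa using hε
  obtain ⟨t, U, c, hU, hc⟩ := hst.exists_finite_wandering_cover hK hp hε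
  set K := (Metric.ball p (ε / 2))ᶜ with hKdef
  refine ⟨K, hK, hp, (t.card + 1) ^ t.card, fun n E hE => ?_⟩
  have hcard : E.card ≤ (t.card + 1) ^ t.card * (E.image (visits f n K)).card := by
    refine Finset.card_le_mul_card_image E _ fun A hA => ?_
    obtain ⟨x₀, -, rfl⟩ := Finset.mem_image.1 hA
    set A := visits f n K x₀
    calc (E.filter fun x => visits f n K x = A).card
        ≤ (A.pi fun _ => t).card := by
          refine Finset.card_le_card_of_injOn (fun x k _ => c (f^[k] x)) ?_ ?_
          · intro x hx
            have hxA := (Finset.mem_filter.1 hx).2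
            refine Finset.mem_coe.2 (Finset.mem_pi.2 fun k hk => ?_)
            rw [← hxA] at hk
            exact (hc _ (mem_visits.1 hk).2).1
          · intro x hx y hy hxy
            obtain ⟨hxE, hxA⟩ := Finset.mem_filter.1 hx
            obtain ⟨hyE, hyA⟩ := Finset.mem_filter.1 hy
            by_contra hne
            obtain ⟨k, hk, hlt⟩ := hE x hxE y hyE hne
            refine hlt.not_ge ?_
            by_cases hkA : k ∈ A
            · have hx' := hc _ (mem_visits.1 (hxA.symm ▸ hkA)).2
              have hy' := hc _ (mem_visits.1 (hyA.symm ▸ hkA)).2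
              have hlabel : c (f^[k] x) = c (f^[k] y) := congrFun (congrFun hxy k) hkA
              rw [← hlabel] at hy'
              exact (hU _ hx'.1).2 _ hx'.2 _ hy'.2
            · have hmem : ∀ z, visits f n K z = A → dist (f^[k] z) p < ε / 2 := by
                intro z hz
                rw [← hz, mem_visits] at hkA
                by_contra hd
                exact hkA ⟨hk, by simpa [hKdef] using hd⟩
              linarith [dist_triangle_right (f^[k] x) (f^[k] y) p, hmem x hxA, hmem y hyA]
      _ = t.card ^ A.card := by simp [Finset.card_pi]
      _ ≤ (t.card + 1) ^ A.card := Nat.pow_le_pow_left (Nat.le_succ _) _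
      _ ≤ (t.card + 1) ^ t.card :=
          Nat.pow_le_pow_right (Nat.succ_pos _) (card_visits_le (fun i hi => (hU i hi).1) hc n x₀)
  refine hcard.trans (Nat.mul_le_mul_left _ ?_)
  rw [← ncard_coe_finset]
  exact ncard_le_ncard (by rw [Finset.coe_image]; exact image_subset_range _ _)
    (finite_range_visits _ _ _)

theorem StandingSetting.bddAbove_card_isDynSeparated {X : Type*} [MetricSpace X]
    [CompactSpace X] {f : X ≃ₜ X} {p : X} (hst : StandingSetting f p) {ε : ℝ} (hε : 0 < ε)
    (n : ℕ) : BddAbove {m | ∃ E : Finset X, IsDynSeparated f n ε ↑E ∧ E.card = m} := by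
  obtain ⟨K, -, -, C, hC⟩ := hst.exists_card_le_mul_ncard_visits hε
  refine ⟨C * (range (visits f n K)).ncard, ?_⟩
  rintro _ ⟨E, hE, rfl⟩
  exact hC n E hE

theorem exists_isDynSeparated_card_eq_maxSep {X : Type*} [MetricSpace X] {f : X → X} {n : ℕ}
    {ε : ℝ} (hb : BddAbove {m | ∃ E : Finset X, IsDynSeparated f n ε ↑E ∧ E.card = m}) :
    ∃ E : Finset X, IsDynSeparated f n ε ↑E ∧ E.card = maxSep f n ε := by
  have hne : {m | ∃ E : Finset X, IsDynSeparated f n ε ↑E ∧ E.card = m}.Nonempty :=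
    ⟨0, ∅, by simp [IsDynSeparated], rfl⟩
  exact Nat.sSup_mem hne hb

/-- A separated set of maximal cardinality is spanning. -/
theorem exists_forall_dist_iterate_le {X : Type*} [MetricSpace X] {f : X → X} {n : ℕ}
    {ε : ℝ} (hε : 0 < ε)
    (hb : BddAbove {m | ∃ E : Finset X, IsDynSeparated f n ε ↑E ∧ E.card = m}) :
    ∃ E : Finset X, E.card = maxSep f n ε ∧
      ∀ y, ∃ x ∈ E, ∀ k < n, dist (f^[k] y) (f^[k] x) ≤ ε := by
  classical
  obtain ⟨E, hE, hcard⟩ := exists_isDynSeparated_card_eq_maxSep hb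
  refine ⟨E, hcard, fun y => ?_⟩
  by_contra! hy
  have hyE : y ∉ E := fun h => by
    obtain ⟨k, -, hk⟩ := hy y h
    rw [dist_self] at hk
    exact hk.not_gt hε
  have hsep : IsDynSeparated f n ε ↑(insert y E) := by
    intro a ha b hb hab
    rw [Finset.mem_coe, Finset.mem_insert] at ha hb
    rcases ha with rfl | ha <;> rcases hb with rfl | hb
    · exact absurd rfl hab
    · exact hy b hb
    · obtain ⟨k, hk, hlt⟩ := hy a ha
      exact ⟨k, hk, by rwa [dist_comm]⟩
    · exact hE a ha b hb hab
  have hle : (insert y E).card ≤ maxSep f n ε := le_csSup hb ⟨_, hsep, rfl⟩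
  rw [Finset.card_insert_of_notMem hyE] at hle
  omega

/-- Visits to a compact set avoiding the fixed point are controlled by separated sets. -/
theorem StandingSetting.exists_ncard_visits_le_mul_maxSep {X : Type*} [MetricSpace X]
    [CompactSpace X] {f : X ≃ₜ X} {p : X} (hst : StandingSetting f p) {Y : Set X}
    (hY : IsCompact Y) (hp : p ∉ Y) :
    ∃ ε > 0, ∃ C : ℕ, ∀ n : ℕ, (range (visits f n Y)).ncard ≤ C * maxSep f n ε := by
  classical
  obtain ⟨ε, hε, hεY⟩ := hY.exists_cthickening_subset_open (isOpen_compl_singleton (x := p))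
    (by simpa using hp)
  have hK : IsCompact (Metric.cthickening ε Y) := Metric.isClosed_cthickening.isCompact
  have hpK : p ∉ Metric.cthickening ε Y := fun h => hεY h rfl
  obtain ⟨t, U, c, hU, hc⟩ := hst.exists_finite_wandering_cover hK hpK hε
  refine ⟨ε, hε, 2 ^ t.card, fun n => ?_⟩
  obtain ⟨E, hcard, hspan⟩ :=
    exists_forall_dist_iterate_le hε (hst.bddAbove_card_isDynSeparated hε n)
  have hsub : range (visits f n Y) ⊆
      ↑(E.biUnion fun x => (visits f n (Metric.cthickening ε Y) x).powerset) := by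
    rintro _ ⟨y, rfl⟩
    obtain ⟨x, hx, hxy⟩ := hspan y
    refine Finset.mem_coe.2 (Finset.mem_biUnion.2 ⟨x, hx, Finset.mem_powerset.2 fun k hk => ?_⟩)
    obtain ⟨hkn, hky⟩ := mem_visits.1 hk
    refine mem_visits.2 ⟨hkn, Metric.mem_cthickening_of_dist_le _ _ _ _ hky ?_⟩
    rw [dist_comm]
    exact hxy k hkn
  calc (range (visits f n Y)).ncard
      ≤ (E.biUnion fun x => (visits f n (Metric.cthickening ε Y) x).powerset).card := by
        rw [← ncard_coe_finset]
        exact ncard_le_ncard hsub (Finset.finite_toSet _)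
    _ ≤ E.card * 2 ^ t.card := by
        refine Finset.card_biUnion_le_card_mul _ _ _ fun x _ => ?_
        rw [Finset.card_powerset]
        exact Nat.pow_le_pow_right two_pos (card_visits_le (fun i hi => (hU i hi).1) hc n x)
    _ = 2 ^ t.card * maxSep f n ε := by rw [hcard, mul_comm]

/-- localization, compact-set form:
`h_pol(f) = sup { h_pol(f; Y) : Y nonempty compact subset of X ∖ {∞} }`. -/
theorem polEntropy_eq_sup_codingEntropy_compact {X : Type*} [MetricSpace X] [CompactSpace X]
    (f : X ≃ₜ X) (p : X) (hst : StandingSetting f p) :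
    polEntropy ⇑f =
      ⨆ (Y : Set X) (_ : Y.Nonempty ∧ IsCompact Y ∧ p ∉ Y),
        codingEntropy ⇑f {Y} := by
  have : Nonempty X := ⟨p⟩
  apply le_antisymm
  · refine iSup₂_le fun ε hε => ?_
    obtain ⟨K, hK, hp, C, hC⟩ := hst.exists_card_le_mul_ncard_visits hε
    have hle : ∀ n, maxSep f n ε ≤ C * (codings f {K} n).ncard := by
      intro n
      obtain ⟨E, hE, hcard⟩ :=
        exists_isDynSeparated_card_eq_maxSep (hst.bddAbove_card_isDynSeparated hε n)
      rw [← hcard, ncard_codings_singleton]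
      exact hC n E hE
    refine (limsup_log_div_log_le_of_le_mul hle).trans ?_
    rcases K.eq_empty_or_nonempty with rfl | hne
    · have hvisits : ∀ n, visits f n ∅ = fun _ => ∅ := fun n => by
        ext x k
        simp [mem_visits]
      simp [ncard_codings_singleton, hvisits]
    · exact le_iSup₂ (f := fun (Y : Set X) (_ : Y.Nonempty ∧ IsCompact Y ∧ p ∉ Y) =>
        codingEntropy (⇑f) {Y}) K ⟨hne, hK, hp⟩
  · refine iSup₂_le fun Y hY => ?_
    obtain ⟨ε, hε, C, hC⟩ := hst.exists_ncard_visits_le_mul_maxSep hY.2.1 hY.2.2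
    refine (limsup_log_div_log_le_of_le_mul (C := C) (b := fun n => maxSep f n ε)
      fun n => ?_).trans (le_iSup₂ (f := fun (ε : ℝ) (_ : 0 < ε) =>
        Filter.atTop.limsup fun n : ℕ =>
          ENNReal.ofReal (Real.log (maxSep f n ε) / Real.log n)) ε hε)
    rw [ncard_codings_singleton]
    exact hC n
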